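/- Suppose F is immersed in G under P. Let Q be a probability measure equivalent to P on 𝒢 with density ρ = dQ/dP, and set e_t = E_P[ρ | F_t], E_t = E_P[ρ | G_t]. Then F is immersed in G under Q if and only if for every t ≥ 0 and every bounded F_∞-measurable random variable X, E_P[Xρ | G_t] · e_t = E_P[Xρ | F_t] · E_t P-almost surely. -/

import Mathlib

open MeasureTheory Set
open scoped NNReal ENNReal

noncomputable section

namespace DefaultTimes

variable {Ω : Type*}

/-- The progressively enlarged filtration
`G_t = ⋂_{u>t} (F_u ∨ σ(τ ∧ s : s ≤ u))`. -/
def enlargedFiltration {m0 : MeasurableSpace Ω}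
    (F : Filtration ℝ≥0 m0) (τ : Ω → ℝ≥0∞) (hτ : Measurable τ) :
    Filtration ℝ≥0 m0 where
  seq t := ⨅ u ∈ Set.Ioi t, (F u ⊔ ⨆ s ∈ Set.Iic u,
      MeasurableSpace.comap (fun ω => min (τ ω) (s : ℝ≥0∞)) inferInstance)
  mono' := fun i j hij => le_iInf₂ fun u hu => iInf₂_le u (lt_of_le_of_lt hij hu)
  le' := fun t => by
    refine le_trans (iInf₂_le (t + 1) (lt_add_of_pos_right t one_pos)) ?_
    exact sup_le (Filtration.le _ _)
      (iSup₂_le fun s _ => Measurable.comap_le (hτ.min measurable_const))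

/-- `F` is immersed in `G` under `μ` ((H)-hypothesis): every `(F,μ)`-martingale is
a `(G,μ)`-martingale. -/
def Immersion {m0 : MeasurableSpace Ω} (F G : Filtration ℝ≥0 m0) (μ : Measure Ω) : Prop :=
  ∀ f : ℝ≥0 → Ω → ℝ, Martingale f F μ → Martingale f G μ

lemma le_enlargedFiltration {m0 : MeasurableSpace Ω}
    (F : Filtration ℝ≥0 m0) (τ : Ω → ℝ≥0∞) (hτ : Measurable τ) (t : ℝ≥0) :
    F t ≤ enlargedFiltration F τ hτ t :=
  le_iInf₂ fun _ hu => (F.mono (le_of_lt hu)).trans le_sup_left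

/-- The set of functions whose conditional expectations given two σ-algebras agree is closed
under convergence in `L¹`. -/
lemma condExp_ae_eq_of_tendsto_eLpNorm {m m' m0 : MeasurableSpace Ω} {μ : Measure Ω}
    {X : Ω → ℝ} {Y : ℕ → Ω → ℝ} (hX : Integrable X μ) (hY : ∀ n, Integrable (Y n) μ)
    (hlim : Filter.Tendsto (fun n => eLpNorm (Y n - X) 1 μ) Filter.atTop (nhds 0))
    (heq : ∀ᶠ n in Filter.atTop, μ[Y n|m] =ᵐ[μ] μ[Y n|m']) :
    μ[X|m] =ᵐ[μ] μ[X|m'] := by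
  have hbound : ∀ᶠ n in Filter.atTop, eLpNorm (μ[X|m] - μ[X|m']) 1 μ
      ≤ eLpNorm (Y n - X) 1 μ + eLpNorm (Y n - X) 1 μ := by
    filter_upwards [heq] with n hn
    have h : μ[X|m] - μ[X|m'] =ᵐ[μ] μ[Y n - X|m'] - μ[Y n - X|m] := by
      filter_upwards [hn, condExp_sub (hY n) hX m, condExp_sub (hY n) hX m'] with ω h1 h2 h3
      simp only [Pi.sub_apply] at h2 h3 ⊢
      rw [h2, h3, h1]
      ring
    rw [eLpNorm_congr_ae h]
    exact (eLpNorm_sub_le integrable_condExp.aestronglyMeasurable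
      integrable_condExp.aestronglyMeasurable le_rfl).trans
      (add_le_add (eLpNorm_condExp_le_eLpNorm _ le_rfl) (eLpNorm_condExp_le_eLpNorm _ le_rfl))
  have hzero : eLpNorm (μ[X|m] - μ[X|m']) 1 μ = 0 := by
    have hlim' := hlim.add hlim
    rw [add_zero] at hlim'
    exact le_antisymm (ge_of_tendsto hlim' hbound) bot_le
  rw [eLpNorm_eq_zero_iff (integrable_condExp.sub integrable_condExp).aestronglyMeasurable
    one_ne_zero] at hzero
  filter_upwards [hzero] with ω hω
  exact sub_eq_zero.mp hω

/-- An integrable function is the `L¹` limit of its truncations. -/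
lemma tendsto_eLpNorm_clamp {m0 : MeasurableSpace Ω} {μ : Measure Ω}
    {X : Ω → ℝ} (hX : Integrable X μ) :
    Filter.Tendsto (fun n : ℕ => eLpNorm ((fun ω => max (-(n : ℝ)) (min n (X ω))) - X) 1 μ)
      Filter.atTop (nhds 0) := by
  simp only [eLpNorm_one_eq_lintegral_enorm, ← ofReal_norm, Pi.sub_apply]
  refine tendsto_lintegral_norm_of_dominated_convergence (bound := fun ω => |X ω|) ?_
    hX.abs.hasFiniteIntegral ?_ ?_
  · intro n
    exact aestronglyMeasurable_const.sup (aestronglyMeasurable_const.inf hX.aestronglyMeasurable)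
  · intro n
    refine Filter.Eventually.of_forall fun ω => ?_
    have hn : (0 : ℝ) ≤ n := Nat.cast_nonneg n
    rw [Real.norm_eq_abs]
    rcases max_cases (-(n : ℝ)) (min n (X ω)) with h | h <;>
      rcases min_cases (n : ℝ) (X ω) with h' | h' <;>
      rcases abs_cases (X ω) with h'' | h'' <;>
      rw [h.1, abs_le] <;> constructor <;> linarith
  · refine Filter.Eventually.of_forall fun ω => ?_
    obtain ⟨N, hN⟩ := exists_nat_ge |X ω|
    refine tendsto_const_nhds.congr' ?_
    filter_upwards [Filter.eventually_ge_atTop N] with n hn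
    have h : |X ω| ≤ n := hN.trans (by exact_mod_cast hn)
    rw [abs_le] at h
    rw [min_eq_right h.2, max_eq_right h.1]

/-- Immersion amounts to the equality of the conditional expectations of bounded
`F_∞`-measurable variables given `F_t` and given `G_t`. -/
lemma immersion_iff_condExp_ae_eq {m0 : MeasurableSpace Ω} {F G : Filtration ℝ≥0 m0}
    {μ : Measure Ω} [IsFiniteMeasure μ] (hFG : ∀ t, F t ≤ G t) :
    Immersion F G μ ↔ ∀ (t : ℝ≥0) (X : Ω → ℝ), Measurable[⨆ u, F u] X →
      (∃ C, ∀ ω, |X ω| ≤ C) → μ[X|G t] =ᵐ[μ] μ[X|F t] := by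
  have hsup : ⨆ u, F u ≤ m0 := iSup_le F.le
  have hint : ∀ X : Ω → ℝ, Measurable[⨆ u, F u] X → (∃ C, ∀ ω, |X ω| ≤ C) →
      Integrable X μ := by
    rintro X hX ⟨C, hC⟩
    exact Integrable.of_bound (hX.mono hsup le_rfl).aestronglyMeasurable C
      (Filter.Eventually.of_forall hC)
  constructor
  · intro h t X hX hC
    have hXi := hint X hX hC
    let H : Filtration ℕ m0 :=
      ⟨fun n => F n, fun i j hij => F.mono (by exact_mod_cast hij), fun n => F.le n⟩
    have hH : ⨆ u, F u ≤ ⨆ n, H n := by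
      refine iSup_le fun u => ?_
      obtain ⟨n, hn⟩ := exists_nat_ge u
      exact (F.mono hn).trans (le_iSup (fun n => H n) n)
    refine condExp_ae_eq_of_tendsto_eLpNorm (Y := fun n => μ[X|H n]) hXi
      (fun n => integrable_condExp)
      (hXi.tendsto_eLpNorm_condExp (hX.mono hH le_rfl).stronglyMeasurable) ?_
    obtain ⟨N, hN⟩ := exists_nat_ge t
    filter_upwards [Filter.eventually_ge_atTop N] with n hn
    have htn : t ≤ (n : ℝ≥0) := hN.trans (by exact_mod_cast hn)
    have hmart := martingale_condExp X F μ
    exact ((h _ hmart).2 t n htn).trans (hmart.2 t n htn).symm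
  · intro h f hf
    refine ⟨fun t => (hf.1 t).mono (hFG t), fun i j hij => ?_⟩
    refine Filter.EventuallyEq.trans ?_ (hf.2 i j hij)
    have hmeas : ∀ n : ℕ,
        Measurable[⨆ u, F u] fun ω => max (-(n : ℝ)) (min (n : ℝ) (f j ω)) := by
      intro n
      have hj : Measurable[⨆ u, F u] (f j) :=
        (hf.1 j).measurable.mono (le_iSup (fun u => F u) j) le_rfl
      exact measurable_const.max (measurable_const.min hj)
    have hbdd : ∀ n : ℕ, ∃ C, ∀ ω, |max (-(n : ℝ)) (min (n : ℝ) (f j ω))| ≤ C := fun n =>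
      ⟨n, fun ω => abs_le.2 ⟨le_max_left _ _,
        max_le (neg_le_self (Nat.cast_nonneg n)) (min_le_left _ _)⟩⟩
    exact condExp_ae_eq_of_tendsto_eLpNorm (hf.integrable j)
      (fun n => hint _ (hmeas n) (hbdd n)) (tendsto_eLpNorm_clamp (hf.integrable j))
      (Filter.Eventually.of_forall fun n => h i _ (hmeas n) (hbdd n))

lemma integrable_withDensity_ofReal_iff {m0 : MeasurableSpace Ω} {P : Measure Ω}
    {ρ : Ω → ℝ} (hρ_meas : Measurable ρ) (hρ_pos : ∀ ω, 0 < ρ ω) {X : Ω → ℝ} :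
    Integrable X (P.withDensity fun ω => ENNReal.ofReal (ρ ω)) ↔
      Integrable (fun ω => X ω * ρ ω) P := by
  rw [integrable_withDensity_iff_integrable_smul' hρ_meas.ennreal_ofReal (by simp)]
  simp only [ENNReal.toReal_ofReal (hρ_pos _).le, smul_eq_mul, mul_comm]

lemma setIntegral_withDensity_ofReal {m0 : MeasurableSpace Ω} {P : Measure Ω}
    {ρ : Ω → ℝ} (hρ_meas : Measurable ρ) (hρ_pos : ∀ ω, 0 < ρ ω) (X : Ω → ℝ)
    {s : Set Ω} (hs : MeasurableSet s) :
    ∫ ω in s, X ω ∂(P.withDensity fun ω => ENNReal.ofReal (ρ ω)) =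
      ∫ ω in s, X ω * ρ ω ∂P := by
  rw [setIntegral_withDensity_eq_setIntegral_toReal_smul hρ_meas.ennreal_ofReal (by simp) _ hs]
  simp only [ENNReal.toReal_ofReal (hρ_pos _).le, smul_eq_mul, mul_comm]

/-- The abstract Bayes formula. -/
lemma condExp_withDensity_mul_condExp {m m0 : MeasurableSpace Ω} (hm : m ≤ m0)
    {P : Measure Ω} [IsFiniteMeasure P]
    {ρ : Ω → ℝ} (hρ_meas : Measurable ρ) (hρ_pos : ∀ ω, 0 < ρ ω) (hρ_int : Integrable ρ P)
    {X : Ω → ℝ} (hX : Integrable X (P.withDensity fun ω => ENNReal.ofReal (ρ ω))) :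
    (P.withDensity fun ω => ENNReal.ofReal (ρ ω))[X|m] * P[ρ|m]
      =ᵐ[P] P[fun ω => X ω * ρ ω|m] := by
  set Q := P.withDensity fun ω => ENNReal.ofReal (ρ ω) with hQ
  have : IsFiniteMeasure Q := isFiniteMeasure_withDensity_ofReal hρ_int.2
  have hprod : Integrable (Q[X|m] * ρ) P :=
    (integrable_withDensity_ofReal_iff hρ_meas hρ_pos).1 (integrable_condExp (μ := Q))
  refine (condExp_mul_of_stronglyMeasurable_left stronglyMeasurable_condExp hprod
    hρ_int).symm.trans ?_
  refine ae_eq_condExp_of_forall_setIntegral_eq hm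
    ((integrable_withDensity_ofReal_iff hρ_meas hρ_pos).1 hX)
    (fun s _ _ => integrable_condExp.integrableOn) (fun s hs _ => ?_)
    stronglyMeasurable_condExp.aestronglyMeasurable
  rw [setIntegral_condExp hm hprod hs, ← setIntegral_withDensity_ofReal hρ_meas hρ_pos X (hm s hs),
    ← setIntegral_condExp hm hX hs, setIntegral_withDensity_ofReal hρ_meas hρ_pos _ (hm s hs)]
  rfl

lemma condExp_pos_of_pos {m m0 : MeasurableSpace Ω} (hm : m ≤ m0)
    {P : Measure Ω} [IsFiniteMeasure P] {ρ : Ω → ℝ} (hρ_pos : ∀ ω, 0 < ρ ω)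
    (hρ_int : Integrable ρ P) : ∀ᵐ ω ∂P, 0 < P[ρ|m] ω := by
  have hs : MeasurableSet[m] {ω | P[ρ|m] ω ≤ 0} :=
    (stronglyMeasurable_condExp (μ := P) (f := ρ) (m := m)).measurable measurableSet_Iic
  have hle : ∫ ω in {ω | P[ρ|m] ω ≤ 0}, ρ ω ∂P ≤ 0 := by
    rw [← setIntegral_condExp hm hρ_int hs]
    exact setIntegral_nonpos (hm _ hs) fun ω hω => hω
  have hnull : P {ω | P[ρ|m] ω ≤ 0} = 0 := by
    by_contra hne
    refine hle.not_gt ((setIntegral_pos_iff_support_of_nonneg_ae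
      (Filter.Eventually.of_forall fun ω => (hρ_pos ω).le) hρ_int.integrableOn).2 ?_)
    have hsupp : Function.support ρ = Set.univ :=
      Set.eq_univ_of_forall fun ω => (hρ_pos ω).ne'
    rw [hsupp, Set.univ_inter]
    exact pos_iff_ne_zero.2 hne
  rw [ae_iff]
  simpa only [not_lt] using hnull

theorem stmt_10 {m0 : MeasurableSpace Ω} (P : Measure Ω) [IsProbabilityMeasure P]
    (F : Filtration ℝ≥0 m0) (τ : Ω → ℝ≥0∞) (hτ : Measurable τ)
    (hImm : Immersion F (enlargedFiltration F τ hτ) P)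
    (ρ : Ω → ℝ) (hρ_meas : Measurable ρ) (hρ_pos : ∀ ω, 0 < ρ ω)
    (hρ_int : Integrable ρ P) (hρ_one : ∫ ω, ρ ω ∂P = 1)
    (Q : Measure Ω) (hQ : Q = P.withDensity fun ω => ENNReal.ofReal (ρ ω)) :
    Immersion F (enlargedFiltration F τ hτ) Q ↔
      ∀ (t : ℝ≥0) (X : Ω → ℝ),
        Measurable[⨆ u, F u] X → (∃ C, ∀ ω, |X ω| ≤ C) →
        (fun ω => (P[fun ω' => X ω' * ρ ω'|enlargedFiltration F τ hτ t]) ω * (P[ρ|F t]) ω)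
          =ᵐ[P]
        fun ω => (P[fun ω' => X ω' * ρ ω'|F t]) ω *
          (P[ρ|enlargedFiltration F τ hτ t]) ω := by
  subst hQ
  have : IsFiniteMeasure (P.withDensity fun ω => ENNReal.ofReal (ρ ω)) :=
    isFiniteMeasure_withDensity_ofReal hρ_int.2
  rw [immersion_iff_condExp_ae_eq (le_enlargedFiltration F τ hτ)]
  set G := enlargedFiltration F τ hτ
  refine forall₄_congr fun t X hX hC => ?_
  have hXi : Integrable X (P.withDensity fun ω => ENNReal.ofReal (ρ ω)) :=
    Integrable.of_bound (hX.mono (iSup_le F.le) le_rfl).aestronglyMeasurable hC.choose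
      (Filter.Eventually.of_forall hC.choose_spec)
  have hae : ae (P.withDensity fun ω => ENNReal.ofReal (ρ ω)) = ae P :=
    le_antisymm (withDensity_absolutelyContinuous _ _).ae_le
      (withDensity_absolutelyContinuous' hρ_meas.ennreal_ofReal.aemeasurable
        (Filter.Eventually.of_forall fun ω => by simp [hρ_pos ω])).ae_le
  rw [hae]
  refine Filter.eventually_congr ?_
  filter_upwards [condExp_withDensity_mul_condExp (G.le t) hρ_meas hρ_pos hρ_int hXi,
    condExp_withDensity_mul_condExp (F.le t) hρ_meas hρ_pos hρ_int hXi,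
    condExp_pos_of_pos (G.le t) hρ_pos hρ_int, condExp_pos_of_pos (F.le t) hρ_pos hρ_int]
    with ω hG hF hGpos hFpos
  rw [← hG, ← hF, Pi.mul_apply, Pi.mul_apply, mul_assoc, mul_assoc,
    mul_comm (P[ρ|F t] ω) (P[ρ|G t] ω), mul_left_inj' (mul_pos hGpos hFpos).ne']

end DefaultTimes
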